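/- If k is relatively prime to 2n−1, then the cardinality of M_{2n,k} is congruent to 0 modulo (2n−1)². -/

import Mathlib

/-- The representative of `x : ZMod n` in `{1, …, n}` (so `0` represents `n`). -/
def repr1 (n : ℕ) (x : ZMod n) : ℕ := if x = 0 then n else x.val

/-- Values of `ZMod n`, embedded into `ZMod (n+1)` via representatives in `{1, …, n}`. -/
def emb (n : ℕ) (x : ZMod n) : ZMod (n + 1) := (repr1 n x : ZMod (n + 1))

/-- `L 0 = 0` and `L i = π(i)` for `i ∈ {1,…,n}`: the listing used to build
the cycle `Y_π = (π(n) π(n−1) … π(1) 0)`. -/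
def listFun (n : ℕ) (π : Equiv.Perm (ZMod n)) : ZMod (n + 1) → ZMod (n + 1) :=
  fun i => if i = 0 then 0 else emb n (π (i.val : ZMod n))

/-- The inverse listing of `listFun`. -/
def listInv (n : ℕ) (π : Equiv.Perm (ZMod n)) : ZMod (n + 1) → ZMod (n + 1) :=
  fun y => if y = 0 then 0 else emb n (π.symm (y.val : ZMod n))

/-- The cycle `Y_π = (π(n) π(n−1) … π(1) 0)` on `{0,1,…,n}`, as a function:
it sends `L(i)` to `L(i-1)`. -/
def Yfun (n : ℕ) (π : Equiv.Perm (ZMod n)) : ZMod (n + 1) → ZMod (n + 1) :=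
  fun y => listFun n π (listInv n π y - 1)

/-- `C_π = Y_π ∘ X_n`, where `X_n` is the cycle `(0 1 2 … n)`, i.e. `x ↦ x + 1`. -/
def Cfun (n : ℕ) (π : Equiv.Perm (ZMod n)) : ZMod (n + 1) → ZMod (n + 1) :=
  fun x => Yfun n π (x + 1)

/-- The strategic pile of `π ∈ S_n`: the set of values appearing strictly after `n` and
strictly before `0` on the cycle of `C_π` containing `0` and `n` (empty if `0` and `n`
lie in different cycles). -/
def strategicPile (n : ℕ) (π : Equiv.Perm (ZMod n)) : Set (ZMod (n + 1)) :=
  {x | ∃ k m : ℕ, 0 < k ∧ k < m ∧ (Cfun n π)^[m] (n : ZMod (n + 1)) = 0 ∧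
      (∀ j, 0 < j → j < m → (Cfun n π)^[j] (n : ZMod (n + 1)) ≠ 0) ∧
      (Cfun n π)^[k] (n : ZMod (n + 1)) = x}

/-- `π ∈ S_n` has maximal strategic pile. -/
def MaxPile (n : ℕ) (π : Equiv.Perm (ZMod n)) : Prop :=
  (Even n ∧ (strategicPile n π).ncard = n - 1) ∨
  (Odd n ∧ (strategicPile n π).ncard = n - 2)

/-- The position (in `{1,…,n}`) of the value `v` in `π`. -/
def idx (n : ℕ) (π : Equiv.Perm (ZMod n)) (v : ZMod n) : ℕ := repr1 n (π.symm v)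

/-- Word coordinate of the occurrence of the pointer `(p,p+1)` as the right pointer of the
entry `p`:  the entry at position `i` is given word coordinate `3*i - 1`, its left pointer
coordinate `3*i - 2` and its right pointer coordinate `3*i`. -/
def posR (n : ℕ) (π : Equiv.Perm (ZMod n)) (p : ZMod n) : ℕ := 3 * idx n π p

/-- Word coordinate of the occurrence of the pointer `(p,p+1)` as the left pointer of the
entry `p+1`. -/
def posL (n : ℕ) (π : Equiv.Perm (ZMod n)) (p : ZMod n) : ℕ := 3 * idx n π (p + 1) - 2

/-- Two pairs of positions interleave (pattern `a b a b` or `b a b a`). -/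
def Interleaved (a1 a2 b1 b2 : ℕ) : Prop :=
  (min a1 a2 < min b1 b2 ∧ min b1 b2 < max a1 a2 ∧ max a1 a2 < max b1 b2) ∨
  (min b1 b2 < min a1 a2 ∧ min a1 a2 < max b1 b2 ∧ max b1 b2 < max a1 a2)

/-- `(p, q)` is a valid pointer context for `π`: the two pointers are distinct and their
occurrences in the pointer word of `π` appear in the order `p,q,p,q` or `q,p,q,p`. -/
def ValidContext (n : ℕ) (π : Equiv.Perm (ZMod n)) (p q : ZMod n) : Prop :=
  p ≠ q ∧ Interleaved (posR n π p) (posL n π p) (posR n π q) (posL n π q)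

/-- The number of (unordered) valid pointer contexts of `π`. -/
noncomputable def numContexts (n : ℕ) (π : Equiv.Perm (ZMod n)) : ℕ :=
  {pq : ZMod n × ZMod n | ValidContext n π pq.1 pq.2}.ncard / 2

/-- `ρ ∈ S_{2n−1}` is the contraction of `π ∈ S_{2n}`, obtained by deleting the entry `2n`. -/
def IsContraction (n : ℕ) (ρ : Equiv.Perm (ZMod (2 * n - 1)))
    (π : Equiv.Perm (ZMod (2 * n))) : Prop :=
  ∃ m : ℕ, 1 ≤ m ∧ m ≤ 2 * n ∧ π (m : ZMod (2 * n)) = ((2 * n : ℕ) : ZMod (2 * n)) ∧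
    (∀ k : ℕ, 1 ≤ k → k < m →
      ρ (k : ZMod (2 * n - 1)) =
        ((repr1 (2 * n) (π (k : ZMod (2 * n))) : ℕ) : ZMod (2 * n - 1))) ∧
    (∀ k : ℕ, m ≤ k → k ≤ 2 * n - 1 →
      ρ (k : ZMod (2 * n - 1)) =
        ((repr1 (2 * n) (π ((k + 1 : ℕ) : ZMod (2 * n))) : ℕ) : ZMod (2 * n - 1)))

/-- `M_{2n}`: the contractions of permutations in `S_{2n}` with maximal strategic pile. -/
def MsetAll (n : ℕ) : Set (Equiv.Perm (ZMod (2 * n - 1))) :=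
  {ρ | ∃ π : Equiv.Perm (ZMod (2 * n)), MaxPile (2 * n) π ∧ IsContraction n ρ π}

/-- `M_{2n,k}`: the contractions of permutations in `S_{2n}` with maximal strategic pile
and exactly `k` valid pointer contexts. -/
def Mset (n k : ℕ) : Set (Equiv.Perm (ZMod (2 * n - 1))) :=
  {ρ | ρ ∈ MsetAll n ∧ numContexts (2 * n - 1) ρ = k}

/-- Cyclic shift by `a`: `C_a(π)(x) = π(x - a)`. -/
def Cshift (n : ℕ) (a : ZMod n) (π : Equiv.Perm (ZMod n)) : Equiv.Perm (ZMod n) :=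
  (Equiv.subRight a).trans π

/-- Translation by `b`: `T_b(π)(x) = π(x) + b`. -/
def Tshift (n : ℕ) (b : ZMod n) (π : Equiv.Perm (ZMod n)) : Equiv.Perm (ZMod n) :=
  π.trans (Equiv.addRight b)

/-- `φ(a,b,π) = C_a(T_b(π))`, i.e. `x ↦ π(x-a) + b`. -/
def phiAct (n : ℕ) (a b : ZMod n) (π : Equiv.Perm (ZMod n)) : Equiv.Perm (ZMod n) :=
  Cshift n a (Tshift n b π)

/-- The difference sequence of `π`. -/
def Dseq (n : ℕ) (π : Equiv.Perm (ZMod n)) : ZMod n → ZMod n :=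
  fun k => π (k + 1) - π k

/-- The difference sequence of `π` is periodic with (least) period `p`, `0 < p < n`. -/
def PeriodicWith (n : ℕ) (π : Equiv.Perm (ZMod n)) (p : ℕ) : Prop :=
  0 < p ∧ p < n ∧ (∀ k : ZMod n, Dseq n π (k + (p : ZMod n)) = Dseq n π k) ∧
    ∀ q : ℕ, 0 < q → q < p → ¬ ∀ k : ZMod n, Dseq n π (k + (q : ZMod n)) = Dseq n π k

theorem card_dvd_ncard_of_free {G X : Type*} [AddGroup G] [AddAction G X] (S : Set X)
    (hS : ∀ (g : G), ∀ x ∈ S, g +ᵥ x ∈ S) (hfree : ∀ (g : G), ∀ x ∈ S, g +ᵥ x = x → g = 0) :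
    Nat.card G ∣ S.ncard := by
  let _ : AddAction G S :=
    { vadd := fun g x => ⟨g +ᵥ x.1, hS g x.1 x.2⟩
      zero_vadd := fun x => Subtype.ext (zero_vadd G x.1)
      add_vadd := fun g h x => Subtype.ext (add_vadd g h x.1) }
  have h : ∀ x : S, AddAction.stabilizer G x = ⊥ := by
    intro x
    rw [eq_bot_iff]
    intro g hg
    exact hfree g x.1 x.2 (congrArg Subtype.val hg)
  rw [← Nat.card_coe_set_eq, Nat.card_congr (AddAction.selfEquivOrbitsQuotientProd h), Nat.card_prod]
  exact Dvd.intro_left _ rfl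

theorem even_ncard_of_swap {X : Type*} [Finite X] (S : Set (X × X))
    (hS : ∀ x ∈ S, x.swap ∈ S) (hne : ∀ x ∈ S, x.1 ≠ x.2) : Even S.ncard := by
  classical
  have := Fintype.ofFinite X
  rw [Set.ncard_eq_toFinset_card', ← ZMod.natCast_eq_zero_iff_even, Finset.card_eq_sum_ones]
  push_cast
  refine Finset.sum_involution (fun x _ => x.swap) (fun _ _ => by decide) ?_ ?_ (fun _ _ => Prod.swap_swap _)
  · intro x hx _ h
    rw [Set.mem_toFinset] at hx
    exact hne x hx (congrArg Prod.fst h).symm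
  · intro x hx
    rw [Set.mem_toFinset] at hx ⊢
    exact hS x hx

section repr1

variable {N : ℕ} [NeZero N]

theorem repr1_pos (x : ZMod N) : 1 ≤ repr1 N x := by
  unfold repr1
  split_ifs with h
  · exact NeZero.one_le
  · exact Nat.one_le_iff_ne_zero.2 ((ZMod.val_ne_zero x).2 h)

theorem repr1_le (x : ZMod N) : repr1 N x ≤ N := by
  unfold repr1
  split_ifs with h
  · exact le_rfl
  · exact (ZMod.val_lt x).le

theorem cast_repr1 (x : ZMod N) : (repr1 N x : ZMod N) = x := by
  unfold repr1
  split_ifs with h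
  · simp [h]
  · simp

omit [NeZero N] in
theorem eq_of_cast_eq {i j : ℕ} (hi : 1 ≤ i) (hi' : i ≤ N) (hj : 1 ≤ j) (hj' : j ≤ N)
    (h : (i : ZMod N) = j) : i = j := by
  rw [ZMod.natCast_eq_natCast_iff] at h
  have := (Nat.modEq_iff_dvd.1 h)
  obtain ⟨c, hc⟩ := this
  have h1 : c < 1 := by by_contra hh; nlinarith
  have h2 : -1 < c := by by_contra hh; nlinarith
  obtain rfl : c = 0 := by omega
  omega

theorem repr1_cast {i : ℕ} (hi : 1 ≤ i) (hi' : i ≤ N) : repr1 N (i : ZMod N) = i :=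
  eq_of_cast_eq (repr1_pos _) (repr1_le _) hi hi' (cast_repr1 _)

theorem repr1_injective : Function.Injective (repr1 N) := fun x y h => by
  rw [← cast_repr1 x, h, cast_repr1]

omit [NeZero N] in
theorem cast_ne_zero {i : ℕ} (hi : 1 ≤ i) (hi' : i ≤ N) : (i : ZMod (N + 1)) ≠ 0 := by
  rw [Ne, ZMod.natCast_eq_zero_iff]
  exact Nat.not_dvd_of_pos_of_lt hi (by omega)

theorem exists_nat_eq (x : ZMod N) : ∃ i : ℕ, 1 ≤ i ∧ i ≤ N ∧ x = i :=
  ⟨repr1 N x, repr1_pos x, repr1_le x, (cast_repr1 x).symm⟩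

omit [NeZero N] in
/-- Every nonzero element of `ZMod (N + 1)` is a natural number in `{1, …, N}`. -/
theorem eq_zero_or_exists_nat_eq (x : ZMod (N + 1)) : x = 0 ∨ ∃ i : ℕ, 1 ≤ i ∧ i ≤ N ∧ x = i := by
  by_cases h : x = 0
  · exact Or.inl h
  · refine Or.inr ⟨x.val, Nat.one_le_iff_ne_zero.2 ((ZMod.val_ne_zero x).2 h), ?_, by simp⟩
    have := ZMod.val_lt x
    omega

omit [NeZero N] in
theorem listFun_zero (π : Equiv.Perm (ZMod N)) : listFun N π 0 = 0 := if_pos rfl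

omit [NeZero N] in
theorem listFun_cast (π : Equiv.Perm (ZMod N)) {i : ℕ} (hi : 1 ≤ i) (hi' : i ≤ N) :
    listFun N π (i : ZMod (N + 1)) = (repr1 N (π i) : ZMod (N + 1)) := by
  rw [listFun, if_neg (cast_ne_zero hi hi'), ZMod.val_natCast_of_lt (by omega), emb]

theorem listInv_listFun (π : Equiv.Perm (ZMod N)) (i : ZMod (N + 1)) :
    listInv N π (listFun N π i) = i := by
  obtain rfl | ⟨i, hi, hi', rfl⟩ := eq_zero_or_exists_nat_eq i
  · rw [listFun_zero]
    exact if_pos rfl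
  · have h2 := repr1_le (π i)
    rw [listFun_cast π hi hi', listInv, if_neg (cast_ne_zero (repr1_pos _) h2),
      ZMod.val_natCast_of_lt (by omega), cast_repr1, Equiv.symm_apply_apply, emb,
      repr1_cast hi hi']

theorem listFun_surjective (π : Equiv.Perm (ZMod N)) : Function.Surjective (listFun N π) :=
  Finite.surjective_of_injective (Function.LeftInverse.injective (listInv_listFun π))

theorem Cfun_listFun (π : Equiv.Perm (ZMod N)) (i x : ZMod (N + 1)) (h : x + 1 = listFun N π i) :
    Cfun N π x = listFun N π (i - 1) := by
  rw [Cfun, Yfun, h, listInv_listFun]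

theorem Cfun_surjective (π : Equiv.Perm (ZMod N)) : Function.Surjective (Cfun N π) := by
  intro z
  obtain ⟨i, rfl⟩ := listFun_surjective π z
  exact ⟨listFun N π (i + 1) - 1, by rw [Cfun_listFun π (i + 1) _ (by ring)]; ring_nf⟩

end repr1

/-- Every nonempty forward-invariant set is everything. -/
def ForwardTransitive {α : Type*} (f : α → α) : Prop :=
  ∀ S : Set α, S.Nonempty → (∀ x ∈ S, f x ∈ S) → S = Set.univ

theorem ForwardTransitive.exists_iterate {α : Type*} {f : α → α} (h : ForwardTransitive f)
    (x y : α) : ∃ k, f^[k] x = y := by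
  have := h {y | ∃ k, f^[k] x = y} ⟨x, 0, rfl⟩ (by
    rintro _ ⟨k, rfl⟩
    exact ⟨k + 1, Function.iterate_succ_apply' f k x⟩)
  change y ∈ {y | ∃ k, f^[k] x = y}
  rw [this]
  exact Set.mem_univ y

theorem ForwardTransitive.semiconj {α : Type*} {f g : α → α} (e : α ≃ α)
    (hfg : ∀ x, g (e x) = e (f x)) (h : ForwardTransitive f) : ForwardTransitive g := by
  rintro S ⟨s, hs⟩ hS
  have := h (e ⁻¹' S) ⟨e.symm s, by simpa⟩ (fun x hx => by
    have := hS _ hx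
    rwa [hfg] at this)
  ext x
  have hx : e.symm x ∈ e ⁻¹' S := this ▸ Set.mem_univ _
  simpa using hx

/-- The points met strictly between `a` and the first return to `b` are all points other than
`a` and `b` exactly when `f` is a full cycle in which `b` is followed by `a`. -/
theorem ncard_between_iff {α : Type*} [Finite α] {f : α → α} (hf : Function.Surjective f)
    {a b : α} (hab : a ≠ b) (hcard : 3 ≤ Nat.card α) :
    {x | ∃ k m : ℕ, 0 < k ∧ k < m ∧ f^[m] a = b ∧ (∀ j, 0 < j → j < m → f^[j] a ≠ b) ∧
      f^[k] a = x}.ncard = Nat.card α - 2 ↔ f b = a ∧ ForwardTransitive f := by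
  set P := {x | ∃ k m : ℕ, 0 < k ∧ k < m ∧ f^[m] a = b ∧ (∀ j, 0 < j → j < m → f^[j] a ≠ b) ∧
      f^[k] a = x} with hP
  have hsub : P ⊆ {a, b}ᶜ := by
    rintro x ⟨k, m, hk, hkm, hm, hj, rfl⟩
    simp only [Set.mem_compl_iff, Set.mem_insert_iff, Set.mem_singleton_iff, not_or]
    refine ⟨fun h => hj (m - k) (by omega) (by omega) ?_, hj k hk hkm⟩
    conv_lhs => rw [← h]
    rw [← Function.iterate_add_apply, Nat.sub_add_cancel hkm.le, hm]
  have hc : ({a, b}ᶜ : Set α).ncard = Nat.card α - 2 := by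
    rw [Set.ncard_compl, Set.ncard_pair hab]
  have hiff : P.ncard = Nat.card α - 2 ↔ P = {a, b}ᶜ := by
    constructor
    · intro h
      exact Set.eq_of_subset_of_ncard_le hsub (by rw [hc, h])
    · intro h
      rw [h, hc]
  rw [hiff]
  constructor
  · intro hPe
    have hba : f b = a := by
      obtain ⟨x, hx⟩ := hf a
      by_cases hxb : x = b
      · rwa [← hxb]
      by_cases hxa : x = a
      · exfalso
        rw [hxa] at hx
        have hit : ∀ k, f^[k] a = a := fun k => Function.iterate_fixed hx k
        have hne : P.Nonempty := by
          rw [← Set.ncard_pos, hiff.2 hPe]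
          omega
        obtain ⟨_, k, m, -, -, hm, -⟩ := hne
        exact hab ((hit m).symm.trans hm)
      · exfalso
        have hxP : x ∈ P := by
          rw [hPe]
          simp [hxa, hxb]
        obtain ⟨k, m, hk, hkm, hm, hj, rfl⟩ := hxP
        rw [← Function.iterate_succ_apply' f] at hx
        rcases Nat.lt_or_ge (k + 1) m with h | h
        · exact absurd (show a ∈ P from ⟨k + 1, m, by omega, h, hm, hj, hx⟩) (fun h => hsub h (by simp))
        · obtain rfl : m = k + 1 := by omega
          exact hab (hx.symm.trans hm)
    refine ⟨hba, ?_⟩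
    rintro S ⟨s, hs⟩ hS
    have hit : ∀ k, ∀ x ∈ S, f^[k] x ∈ S := by
      intro k
      induction k with
      | zero => exact fun x hx => hx
      | succ k ih => exact fun x hx => ih _ (hS _ hx)
    have ha : a ∈ S := by
      by_cases hsa : s = a
      · rwa [← hsa]
      by_cases hsb : s = b
      · rw [← hba, ← hsb]
        exact hS _ hs
      have hsP : s ∈ P := by
        rw [hPe]
        simp [hsa, hsb]
      obtain ⟨k, m, hk, hkm, hm, hj, rfl⟩ := hsP
      rw [← hba]
      apply hS
      have := hit (m - k) _ hs
      rwa [← Function.iterate_add_apply, Nat.sub_add_cancel hkm.le, hm] at this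
    have hcompl : ∀ x, x ≠ b → x ∈ S := by
      intro x hxb
      by_cases hxa : x = a
      · rwa [hxa]
      have hxP : x ∈ P := by
        rw [hPe]
        simp [hxa, hxb]
      obtain ⟨k, m, hk, hkm, hm, hj, rfl⟩ := hxP
      exact hit k a ha
    ext x
    simp only [Set.mem_univ, iff_true]
    by_cases hxb : x = b
    · have hne : P.Nonempty := by
        rw [← Set.ncard_pos, hiff.2 hPe]
        omega
      obtain ⟨_, k, m, -, -, hm, -⟩ := hne
      rw [hxb, ← hm]
      exact hit m a ha
    · exact hcompl x hxb
  · rintro ⟨hba, ht⟩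
    refine Set.Subset.antisymm hsub ?_
    intro x hx
    simp only [Set.mem_compl_iff, Set.mem_insert_iff, Set.mem_singleton_iff, not_or] at hx
    classical
    have hex := ht.exists_iterate a b
    set m := Nat.find hex with hm
    have hmb : f^[m] a = b := Nat.find_spec hex
    have hper : Function.IsPeriodicPt f (m + 1) a := by
      rw [Function.IsPeriodicPt, Function.IsFixedPt, Function.iterate_succ_apply', hmb, hba]
    obtain ⟨k, rfl⟩ := ht.exists_iterate a x
    rw [← hper.iterate_mod_apply k] at hx ⊢
    have hlt : k % (m + 1) < m + 1 := Nat.mod_lt _ (by omega)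
    generalize k % (m + 1) = r at hx hlt
    have h0 : r ≠ 0 := by
      rintro rfl
      exact hx.1 rfl
    have h1 : r ≠ m := by
      rintro rfl
      exact hx.2 hmb
    exact ⟨r, m, by omega, by omega, hmb, fun j _ hj => Nat.find_min hex hj, rfl⟩

theorem maxPile_iff {n : ℕ} (hn : 0 < n) (π : Equiv.Perm (ZMod (2 * n))) :
    MaxPile (2 * n) π ↔
      Cfun (2 * n) π 0 = ((2 * n : ℕ) : ZMod (2 * n + 1)) ∧ ForwardTransitive (Cfun (2 * n) π) := by
  have : NeZero (2 * n) := ⟨by omega⟩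
  have h := ncard_between_iff (Cfun_surjective π) (a := ((2 * n : ℕ) : ZMod (2 * n + 1))) (b := 0)
    (cast_ne_zero (by omega) le_rfl) (by rw [Nat.card_zmod]; omega)
  rw [Nat.card_zmod] at h
  rw [← h, MaxPile, strategicPile]
  have : ¬ Odd (2 * n) := by simp
  simp [this]

theorem forwardTransitive_iff_of_skip {α β : Type*} {f : β → β} {g : α → α} {ι : α → β}
    (hι : Function.Injective ι) {a b : β} (hf : Function.Surjective f) (hba : f b = a)
    (hab : a ≠ b) (hfa : f a ≠ b) (hιa : ∀ x, ι x ≠ a) (hιb : ∀ x, ι x ≠ b)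
    (hcov : ∀ y, y = a ∨ y = b ∨ ∃ x, y = ι x)
    (hstep : ∀ x, f (ι x) = ι (g x) ∨ (f (ι x) = b ∧ f a = ι (g x))) :
    ForwardTransitive f ↔ ForwardTransitive g := by
  obtain ⟨u, hu⟩ : ∃ u, f (ι u) = b := by
    obtain ⟨y, hy⟩ := hf b
    obtain rfl | rfl | ⟨x, rfl⟩ := hcov y
    · exact absurd hy hfa
    · exact absurd (hba.symm.trans hy) hab
    · exact ⟨x, hy⟩
  have hau : f a = ι (g u) := by
    rcases hstep u with h | h
    · exact absurd (h.symm.trans hu) (hιb _)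
    · exact h.2
  constructor
  · rintro ht S ⟨s, hs⟩ hS
    by_cases huS : ∃ x ∈ S, f (ι x) = b
    · obtain ⟨v, hvS, hv⟩ := huS
      have hav : f a = ι (g v) := by
        rcases hstep v with h | h
        · exact absurd (h.symm.trans hv) (hιb _)
        · exact h.2
      have hall := ht (ι '' S ∪ {a, b}) ⟨a, by simp⟩ (by
        rintro y (⟨x, hx, rfl⟩ | rfl | rfl)
        · rcases hstep x with h | h
          · exact Or.inl ⟨g x, hS x hx, h.symm⟩
          · exact Or.inr (Or.inr h.1)
        · exact Or.inl ⟨g v, hS v hvS, hav.symm⟩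
        · exact Or.inr (Or.inl hba))
      ext x
      have hx : ι x ∈ ι '' S ∪ {a, b} := hall ▸ Set.mem_univ _
      rcases hx with ⟨z, hz, hzx⟩ | h | h
      · simpa [hι hzx] using hz
      · exact absurd h (hιa x)
      · exact absurd h (hιb x)
    · exfalso
      have hall := ht (ι '' S) ⟨_, s, hs, rfl⟩ (by
        rintro _ ⟨x, hx, rfl⟩
        rcases hstep x with h | h
        · exact ⟨g x, hS x hx, h.symm⟩
        · exact absurd ⟨x, hx, h.1⟩ huS)
      obtain ⟨z, -, hz⟩ : b ∈ ι '' S := hall ▸ Set.mem_univ _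
      exact hιb z hz
  · rintro ht S ⟨s, hs⟩ hS
    have hgS : ∀ x ∈ ι ⁻¹' S, g x ∈ ι ⁻¹' S := by
      intro x hx
      have h1 := hS _ hx
      rcases hstep x with h | h
      · rwa [h] at h1
      · have h2 := hS _ (hS _ h1)
        rwa [h.1, hba, h.2] at h2
    have hne : (ι ⁻¹' S).Nonempty := by
      obtain rfl | rfl | ⟨x, rfl⟩ := hcov s
      · exact ⟨g u, by simpa [hau] using hS _ hs⟩
      · exact ⟨g u, by simpa [hba, hau] using hS _ (hS _ hs)⟩
      · exact ⟨x, hs⟩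
    have hall := ht _ hne hgS
    have hmem : ∀ x, ι x ∈ S := fun x => by
      have : x ∈ ι ⁻¹' S := hall ▸ Set.mem_univ x
      exact this
    have hb : b ∈ S := hu ▸ hS _ (hmem u)
    ext y
    simp only [Set.mem_univ, iff_true]
    obtain rfl | rfl | ⟨x, rfl⟩ := hcov y
    · exact hba ▸ hS _ hb
    · exact hb
    · exact hmem x

/-- The step `ρ(i) - 1 ↦ ρ(i - 1)`, the analogue of `Cfun` for cyclic lists. -/
def predStep (N : ℕ) (ρ : Equiv.Perm (ZMod N)) : ZMod N → ZMod N :=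
  fun x => ρ (ρ.symm (x + 1) - 1)

theorem repr1_add_one {N : ℕ} [NeZero N] {x : ZMod N} (hx : x ≠ 0) :
    repr1 N (x + 1) = repr1 N x + 1 := by
  have h : ((repr1 N x + 1 : ℕ) : ZMod N) = x + 1 := by
    push_cast
    rw [cast_repr1]
  rw [← h]
  refine repr1_cast (by omega) ?_
  have h1 := repr1_le x
  have h2 : repr1 N x ≠ N := by
    intro h2
    apply hx
    rw [← cast_repr1 x, h2, ZMod.natCast_self]
  omega

/-- Representatives in `{1, …, 2n - 1}`, embedded into `ZMod (2n + 1)`. -/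
def skipEmb (n : ℕ) (x : ZMod (2 * n - 1)) : ZMod (2 * n + 1) :=
  (repr1 (2 * n - 1) x : ZMod (2 * n + 1))

section contraction

variable {n : ℕ} (hn : 2 ≤ n)

include hn

omit hn in
theorem skipEmb_cast {i : ℕ} (hi : 1 ≤ i) (hi' : i ≤ 2 * n - 1) :
    skipEmb n (i : ZMod (2 * n - 1)) = i := by
  have : NeZero (2 * n - 1) := ⟨by omega⟩
  rw [skipEmb, repr1_cast hi hi']

theorem exists_skipEmb_eq (x : ZMod (2 * n - 1)) :
    ∃ i : ℕ, 1 ≤ i ∧ i ≤ 2 * n - 1 ∧ x = i ∧ skipEmb n x = i := by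
  have : NeZero (2 * n - 1) := ⟨by omega⟩
  obtain ⟨i, hi, hi', rfl⟩ := exists_nat_eq x
  exact ⟨i, hi, hi', rfl, skipEmb_cast hi hi'⟩

theorem skipEmb_injective : Function.Injective (skipEmb n) := by
  intro x y h
  obtain ⟨i, hi, hi', rfl, hx⟩ := exists_skipEmb_eq hn x
  obtain ⟨j, hj, hj', rfl, hy⟩ := exists_skipEmb_eq hn y
  rw [hx, hy] at h
  rw [eq_of_cast_eq hi (by omega) hj (by omega) h]

theorem skipEmb_ne_zero (x : ZMod (2 * n - 1)) : skipEmb n x ≠ 0 := by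
  obtain ⟨i, hi, hi', -, hx⟩ := exists_skipEmb_eq hn x
  rw [hx]
  exact cast_ne_zero hi (by omega)

theorem skipEmb_ne_last (x : ZMod (2 * n - 1)) :
    skipEmb n x ≠ ((2 * n : ℕ) : ZMod (2 * n + 1)) := by
  obtain ⟨i, hi, hi', -, hx⟩ := exists_skipEmb_eq hn x
  rw [hx]
  intro h
  have := eq_of_cast_eq hi (by omega) (by omega) (by omega) h
  omega

theorem eq_last_or_eq_zero_or_exists_skipEmb (y : ZMod (2 * n + 1)) :
    y = ((2 * n : ℕ) : ZMod (2 * n + 1)) ∨ y = 0 ∨ ∃ x, y = skipEmb n x := by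
  obtain rfl | ⟨i, hi, hi', rfl⟩ := eq_zero_or_exists_nat_eq y
  · exact Or.inr (Or.inl rfl)
  · by_cases h : i = 2 * n
    · rw [h]
      exact Or.inl rfl
    · exact Or.inr (Or.inr ⟨i, (skipEmb_cast hi (by omega)).symm⟩)

theorem Cfun_last (π : Equiv.Perm (ZMod (2 * n))) :
    Cfun (2 * n) π ((2 * n : ℕ) : ZMod (2 * n + 1)) =
      listFun (2 * n) π ((2 * n : ℕ) : ZMod (2 * n + 1)) := by
  have : NeZero (2 * n) := ⟨by omega⟩
  have h : ((2 * n : ℕ) : ZMod (2 * n + 1)) + 1 = 0 := by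
    have := ZMod.natCast_self (2 * n + 1)
    rwa [Nat.cast_succ] at this
  rw [Cfun_listFun π 0 _ (by rw [h, listFun_zero]), zero_sub, eq_neg_of_add_eq_zero_left h]

theorem Cfun_last_ne_zero (π : Equiv.Perm (ZMod (2 * n))) :
    Cfun (2 * n) π ((2 * n : ℕ) : ZMod (2 * n + 1)) ≠ 0 := by
  have : NeZero (2 * n) := ⟨by omega⟩
  rw [Cfun_last hn, listFun_cast π (by omega) le_rfl]
  exact cast_ne_zero (repr1_pos _) (repr1_le _)

theorem Cfun_skipEmb {π : Equiv.Perm (ZMod (2 * n))} {ρ : Equiv.Perm (ZMod (2 * n - 1))}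
    (hc : IsContraction n ρ π) (h0 : Cfun (2 * n) π 0 = ((2 * n : ℕ) : ZMod (2 * n + 1)))
    (x : ZMod (2 * n - 1)) :
    Cfun (2 * n) π (skipEmb n x) = skipEmb n (predStep (2 * n - 1) ρ x) ∨
      (Cfun (2 * n) π (skipEmb n x) = 0 ∧
        Cfun (2 * n) π ((2 * n : ℕ) : ZMod (2 * n + 1)) =
          skipEmb n (predStep (2 * n - 1) ρ x)) := by
  have : NeZero (2 * n) := ⟨by omega⟩
  have : NeZero (2 * n - 1) := ⟨by omega⟩
  obtain ⟨m, hm1, hm2, hπm, hlt, hge⟩ := hc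
  have hskip : ∀ i : ℕ, 1 ≤ i → i ≤ 2 * n → i ≠ m → ∀ y : ZMod (2 * n - 1),
      y = ((repr1 (2 * n) (π (i : ZMod (2 * n))) : ℕ) : ZMod (2 * n - 1)) →
      listFun (2 * n) π (i : ZMod (2 * n + 1)) = skipEmb n y := by
    rintro i hi hi' him y rfl
    rw [listFun_cast π hi hi', skipEmb_cast (repr1_pos _)]
    have h1 := repr1_le (π (i : ZMod (2 * n)))
    have h2 : repr1 (2 * n) (π (i : ZMod (2 * n))) ≠ 2 * n := by
      intro h
      have h3 := cast_repr1 (π (i : ZMod (2 * n)))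
      rw [h, ← hπm] at h3
      exact him (eq_of_cast_eq hi hi' hm1 hm2 (π.injective h3).symm)
    omega
  have hLlt : ∀ k : ℕ, 1 ≤ k → k < m →
      listFun (2 * n) π (k : ZMod (2 * n + 1)) = skipEmb n (ρ k) := fun k hk hkm =>
    hskip k hk (by omega) (by omega) _ (hlt k hk hkm)
  have hLge : ∀ k : ℕ, m ≤ k → k ≤ 2 * n - 1 →
      listFun (2 * n) π ((k + 1 : ℕ) : ZMod (2 * n + 1)) = skipEmb n (ρ k) := fun k hk hkm =>
    hskip (k + 1) (by omega) (by omega) (by omega) _ (hge k hk hkm)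
  have hLm : listFun (2 * n) π (m : ZMod (2 * n + 1)) = ((2 * n : ℕ) : ZMod (2 * n + 1)) := by
    rw [listFun_cast π hm1 hm2, hπm, repr1_cast (by omega) le_rfl]
  have hC : ∀ (y : ZMod (2 * n + 1)) (i : ℕ),
      y + 1 = listFun (2 * n) π ((i + 1 : ℕ) : ZMod (2 * n + 1)) →
      Cfun (2 * n) π y = listFun (2 * n) π (i : ZMod (2 * n + 1)) := by
    intro y i h
    rw [Cfun_listFun π _ _ h]
    push_cast
    ring_nf
  have hLm1 : listFun (2 * n) π ((m + 1 : ℕ) : ZMod (2 * n + 1)) = 1 := by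
    obtain ⟨i, hi⟩ := listFun_surjective π 1
    have h := Cfun_listFun π i 0 (by rw [hi, zero_add])
    rw [h0, ← hLm] at h
    have h2 := Function.LeftInverse.injective (listInv_listFun π) h
    rw [Nat.cast_succ, h2, sub_add_cancel, hi]
  have hm3 : m ≤ 2 * n - 1 := by
    by_contra hcon
    obtain rfl : m = 2 * n := by omega
    rw [ZMod.natCast_self, listFun_zero] at hLm1
    have h1 := cast_ne_zero (N := 2 * n) (i := 1) le_rfl (by omega)
    rw [Nat.cast_one] at h1
    exact h1 hLm1.symm
  have hone : skipEmb n 1 = 1 := by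
    have := skipEmb_cast (n := n) (i := 1) le_rfl (by omega)
    rwa [Nat.cast_one, Nat.cast_one] at this
  have hρm : ρ m = 1 := by
    apply skipEmb_injective hn
    rw [← hLge m le_rfl hm3, hLm1, hone]
  obtain ⟨k, hk1, hk2, hk⟩ := exists_nat_eq (ρ.symm (x + 1))
  have hx : ρ (k : ZMod (2 * n - 1)) = x + 1 := by rw [← hk, Equiv.apply_symm_apply]
  obtain ⟨j, rfl⟩ : ∃ j, k = j + 1 := ⟨k - 1, by omega⟩
  have hD : predStep (2 * n - 1) ρ x = ρ j := by
    rw [predStep, hk]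
    push_cast
    ring_nf
  rw [hD]
  have hwrap : j = 0 → Cfun (2 * n) π ((2 * n : ℕ) : ZMod (2 * n + 1)) = skipEmb n (ρ j) := by
    rintro rfl
    have h1 := hLge (2 * n - 1) hm3 le_rfl
    rw [Nat.sub_add_cancel (by omega), ZMod.natCast_self] at h1
    rw [Cfun_last hn, h1, Nat.cast_zero]
  by_cases hkm : j + 1 = m
  · have hx0 : x = 0 := by
      rw [hkm, hρm] at hx
      simpa using hx.symm
    have hstep := hC (skipEmb n x) j (by
      rw [hkm, hLm, hx0, ← ZMod.natCast_self (2 * n - 1), skipEmb_cast (by omega) le_rfl,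
        ← Nat.cast_succ]
      congr 1
      omega)
    rw [hstep]
    rcases Nat.eq_zero_or_pos j with h | h
    · refine Or.inr ⟨?_, hwrap h⟩
      rw [h, Nat.cast_zero, listFun_zero]
    · exact Or.inl (hLlt j h (by omega))
  · have hx0 : x ≠ 0 := by
      rintro rfl
      rw [zero_add, ← hρm] at hx
      exact hkm (eq_of_cast_eq hk1 hk2 hm1 hm3 (ρ.injective hx))
    have hxs : skipEmb n x + 1 = skipEmb n (ρ ((j + 1 : ℕ) : ZMod (2 * n - 1))) := by
      rw [hx, skipEmb, skipEmb, repr1_add_one hx0, Nat.cast_succ]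
    rcases Nat.lt_or_ge (j + 1) m with h | h
    · rw [hC (skipEmb n x) j (by rw [hxs, hLlt _ hk1 h])]
      rcases Nat.eq_zero_or_pos j with h | h
      · refine Or.inr ⟨?_, hwrap h⟩
        rw [h, Nat.cast_zero, listFun_zero]
      · exact Or.inl (hLlt j h (by omega))
    · rw [hC (skipEmb n x) (j + 1) (by rw [hxs, hLge _ h hk2])]
      exact Or.inl (hLge j (by omega) (by omega))

theorem forwardTransitive_Cfun_iff {π : Equiv.Perm (ZMod (2 * n))}
    {ρ : Equiv.Perm (ZMod (2 * n - 1))} (hc : IsContraction n ρ π)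
    (h0 : Cfun (2 * n) π 0 = ((2 * n : ℕ) : ZMod (2 * n + 1))) :
    ForwardTransitive (Cfun (2 * n) π) ↔ ForwardTransitive (predStep (2 * n - 1) ρ) :=
  have : NeZero (2 * n) := ⟨by omega⟩
  forwardTransitive_iff_of_skip (skipEmb_injective hn) (Cfun_surjective π) h0
    (cast_ne_zero (by omega) le_rfl) (Cfun_last_ne_zero hn π) (skipEmb_ne_last hn)
    (skipEmb_ne_zero hn) (eq_last_or_eq_zero_or_exists_skipEmb hn) (Cfun_skipEmb hn hc h0)

/-- Every cyclic list of `2n - 1` entries is the contraction of the list obtained by inserting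
`2n` just before the entry `1`. -/
theorem exists_isContraction (ρ : Equiv.Perm (ZMod (2 * n - 1))) :
    ∃ π : Equiv.Perm (ZMod (2 * n)), IsContraction n ρ π ∧
      Cfun (2 * n) π 0 = ((2 * n : ℕ) : ZMod (2 * n + 1)) := by
  have : NeZero (2 * n) := ⟨by omega⟩
  have : NeZero (2 * n - 1) := ⟨by omega⟩
  obtain ⟨m, hm1, hm2, hm⟩ := exists_nat_eq (ρ.symm 1)
  have hρm : ρ m = 1 := by rw [← hm, Equiv.apply_symm_apply]
  set r : ℕ → ℕ := fun i => repr1 (2 * n - 1) (ρ i) with hr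
  have hr1 : ∀ i, 1 ≤ r i := fun i => repr1_pos _
  have hr2 : ∀ i, r i ≤ 2 * n - 1 := fun i => repr1_le _
  have hrinj : ∀ i j, 1 ≤ i → i ≤ 2 * n - 1 → 1 ≤ j → j ≤ 2 * n - 1 → r i = r j → i = j :=
    fun i j hi hi' hj hj' h => eq_of_cast_eq hi hi' hj hj' (ρ.injective (repr1_injective h))
  set l : ℕ → ℕ := fun i => if i < m then r i else if i = m then 2 * n else r (i - 1) with hl
  have hl1 : ∀ i, 1 ≤ l i := by
    intro i
    have := hr1 i
    have := hr1 (i - 1)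
    simp only [hl]
    split_ifs <;> omega
  have hl2 : ∀ i, l i ≤ 2 * n := by
    intro i
    have := hr2 i
    have := hr2 (i - 1)
    simp only [hl]
    split_ifs <;> omega
  have hlinj : ∀ i j, 1 ≤ i → i ≤ 2 * n → 1 ≤ j → j ≤ 2 * n → l i = l j → i = j := by
    intro i j hi hi' hj hj' h
    have h1 := hr2 i
    have h2 := hr2 (i - 1)
    have h3 := hr2 j
    have h4 := hr2 (j - 1)
    have h5 := hrinj i j
    have h6 := hrinj (i - 1) j
    have h7 := hrinj i (j - 1)
    have h8 := hrinj (i - 1) (j - 1)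
    simp only [hl] at h
    split_ifs at h <;> omega
  have hinj : Function.Injective
      (fun x : ZMod (2 * n) => (l (repr1 (2 * n) x) : ZMod (2 * n))) := by
    intro x y h
    exact repr1_injective (hlinj _ _ (repr1_pos _) (repr1_le _) (repr1_pos _) (repr1_le _)
      (eq_of_cast_eq (hl1 _) (hl2 _) (hl1 _) (hl2 _) h))
  set π : Equiv.Perm (ZMod (2 * n)) := Equiv.ofBijective _ (Finite.injective_iff_bijective.1 hinj)
    with hπ
  have hπi : ∀ i : ℕ, 1 ≤ i → i ≤ 2 * n → π (i : ZMod (2 * n)) = (l i : ZMod (2 * n)) := by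
    intro i hi hi'
    rw [hπ, Equiv.ofBijective_apply, repr1_cast hi hi']
  have hlm : l m = 2 * n := by simp [hl]
  have hlm1 : l (m + 1) = 1 := by
    simp only [hl]
    rw [if_neg (by omega), if_neg (by omega)]
    simp only [hr, Nat.add_sub_cancel, hρm]
    have := repr1_cast (N := 2 * n - 1) (i := 1) le_rfl (by omega)
    rwa [Nat.cast_one] at this
  refine ⟨π, ⟨m, hm1, by omega, ?_, ?_, ?_⟩, ?_⟩
  · rw [hπi m hm1 (by omega), hlm]
  · intro k hk hkm
    rw [hπi k hk (by omega), repr1_cast (hl1 _) (hl2 _)]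
    simp only [hl, if_pos hkm, hr, cast_repr1]
  · intro k hk hkm
    rw [hπi (k + 1) (by omega) (by omega), repr1_cast (hl1 _) (hl2 _)]
    simp only [hl]
    rw [if_neg (by omega), if_neg (by omega)]
    simp only [hr, cast_repr1, Nat.add_sub_cancel]
  · rw [Cfun_listFun π ((m + 1 : ℕ) : ZMod (2 * n + 1)), Nat.cast_succ, add_sub_cancel_right,
      listFun_cast π hm1 (by omega), hπi m hm1 (by omega), hlm, repr1_cast (by omega) le_rfl]
    rw [listFun_cast π (by omega) (by omega), hπi (m + 1) (by omega) (by omega), hlm1,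
      repr1_cast le_rfl (by omega), zero_add, Nat.cast_one]

theorem mem_MsetAll_iff (ρ : Equiv.Perm (ZMod (2 * n - 1))) :
    ρ ∈ MsetAll n ↔ ForwardTransitive (predStep (2 * n - 1) ρ) := by
  constructor
  · rintro ⟨π, hmax, hc⟩
    rw [maxPile_iff (by omega)] at hmax
    exact (forwardTransitive_Cfun_iff hn hc hmax.1).1 hmax.2
  · intro h
    obtain ⟨π, hc, h0⟩ := exists_isContraction hn ρ
    exact ⟨π, (maxPile_iff (by omega) π).2 ⟨h0, (forwardTransitive_Cfun_iff hn hc h0).2 h⟩, hc⟩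

end contraction

theorem predStep_phiAct {N : ℕ} (a b : ZMod N) (ρ : Equiv.Perm (ZMod N)) (x : ZMod N) :
    predStep N (phiAct N a b ρ) (x + b) = predStep N ρ x + b := by
  have h : (phiAct N a b ρ).symm (x + b + 1) = ρ.symm (x + 1) + a := by
    rw [Equiv.symm_apply_eq]
    simp [phiAct, Cshift, Tshift]
    ring
  rw [predStep, h]
  simp only [phiAct, Cshift, Tshift, predStep, Equiv.trans_apply, Equiv.subRight_apply,
    Equiv.coe_addRight]
  ring_nf

theorem phiAct_mem_MsetAll {n : ℕ} (hn : 2 ≤ n) (a b : ZMod (2 * n - 1))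
    {ρ : Equiv.Perm (ZMod (2 * n - 1))} (h : ρ ∈ MsetAll n) :
    phiAct (2 * n - 1) a b ρ ∈ MsetAll n := by
  rw [mem_MsetAll_iff hn] at h ⊢
  exact h.semiconj (Equiv.addRight b) (fun x => predStep_phiAct a b ρ x)

/-- Interleaving of chords is determined by the cyclic order of their endpoints. -/
theorem interleaved_iff_of_cyclic (a1 a2 b1 b2 : ℕ) :
    Interleaved a1 a2 b1 b2 ↔
      (((a1 < b1 ∧ b1 < a2) ∨ (b1 < a2 ∧ a2 < a1) ∨ (a2 < a1 ∧ a1 < b1)) ∧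
        ((a2 < b2 ∧ b2 < a1) ∨ (b2 < a1 ∧ a1 < a2) ∨ (a1 < a2 ∧ a2 < b2))) ∨
      (((a1 < b2 ∧ b2 < a2) ∨ (b2 < a2 ∧ a2 < a1) ∨ (a2 < a1 ∧ a1 < b2)) ∧
        ((a2 < b1 ∧ b1 < a1) ∨ (b1 < a1 ∧ a1 < a2) ∨ (a1 < a2 ∧ a2 < b1))) := by
  unfold Interleaved
  rcases le_total a1 a2 with h | h <;> rcases le_total b1 b2 with h' | h' <;>
    simp only [min_eq_left, min_eq_right, max_eq_left, max_eq_right, h, h'] <;> omega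

/-- Cyclic rotation of `{1, …, M}` by `A`, as a relation. -/
def IsRotated (M A i j : ℕ) : Prop := 1 ≤ i ∧ i ≤ M ∧ 1 ≤ j ∧ j ≤ M ∧ (j = i + A ∨ j + M = i + A)

theorem IsRotated.cyclic_iff {M A x y z x' y' z' : ℕ} (hx : IsRotated M A x x')
    (hy : IsRotated M A y y') (hz : IsRotated M A z z') :
    ((x < y ∧ y < z) ∨ (y < z ∧ z < x) ∨ (z < x ∧ x < y)) ↔
      ((x' < y' ∧ y' < z') ∨ (y' < z' ∧ z' < x') ∨ (z' < x' ∧ x' < y')) := by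
  unfold IsRotated at hx hy hz
  omega

theorem IsRotated.interleaved_iff {M A a1 a2 b1 b2 a1' a2' b1' b2' : ℕ}
    (ha1 : IsRotated M A a1 a1') (ha2 : IsRotated M A a2 a2') (hb1 : IsRotated M A b1 b1')
    (hb2 : IsRotated M A b2 b2') :
    Interleaved a1 a2 b1 b2 ↔ Interleaved a1' a2' b1' b2' := by
  rw [interleaved_iff_of_cyclic, interleaved_iff_of_cyclic, ha1.cyclic_iff hb1 ha2,
    ha2.cyclic_iff hb2 ha1, ha1.cyclic_iff hb2 ha2, ha2.cyclic_iff hb1 ha1]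

section contexts

variable {N : ℕ} [NeZero N]

theorem repr1_add (x a : ZMod N) :
    repr1 N (x + a) = repr1 N x + a.val ∨ repr1 N (x + a) + N = repr1 N x + a.val := by
  have h1 := repr1_pos x
  have h2 := repr1_le x
  have h3 := ZMod.val_lt a
  by_cases h : repr1 N x + a.val ≤ N
  · left
    rw [← repr1_cast (N := N) (i := repr1 N x + a.val) (by omega) h]
    simp [cast_repr1]
  · right
    have h4 : repr1 N (x + a) = repr1 N x + a.val - N := by
      rw [← repr1_cast (N := N) (i := repr1 N x + a.val - N) (by omega) (by omega),
        Nat.cast_sub (by omega)]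
      simp [cast_repr1]
    omega

omit [NeZero N] in
theorem idx_phiAct (a b v : ZMod N) (π : Equiv.Perm (ZMod N)) :
    idx N (phiAct N a b π) (v + b) = repr1 N (π.symm v + a) := by
  rw [idx]
  congr 1
  rw [Equiv.symm_apply_eq]
  simp [phiAct, Cshift, Tshift]

theorem validContext_phiAct (a b p q : ZMod N) (π : Equiv.Perm (ZMod N)) :
    ValidContext N (phiAct N a b π) (p + b) (q + b) ↔ ValidContext N π p q := by
  have hR : ∀ v, IsRotated (3 * N) (3 * a.val) (posR N π v)
      (posR N (phiAct N a b π) (v + b)) := by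
    intro v
    rw [posR, posR, idx_phiAct, idx]
    have h1 := repr1_pos (π.symm v)
    have h2 := repr1_le (π.symm v)
    have h3 := repr1_pos (π.symm v + a)
    have h4 := repr1_le (π.symm v + a)
    have h5 := repr1_add (π.symm v) a
    unfold IsRotated
    omega
  have hL : ∀ v, IsRotated (3 * N) (3 * a.val) (posL N π v)
      (posL N (phiAct N a b π) (v + b)) := by
    intro v
    rw [posL, posL, add_right_comm, idx_phiAct, idx]
    have h1 := repr1_pos (π.symm (v + 1))
    have h2 := repr1_le (π.symm (v + 1))
    have h3 := repr1_pos (π.symm (v + 1) + a)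
    have h4 := repr1_le (π.symm (v + 1) + a)
    have h5 := repr1_add (π.symm (v + 1)) a
    unfold IsRotated
    omega
  rw [ValidContext, ValidContext, (hR p).interleaved_iff (hL p) (hR q) (hL q), Ne, Ne,
    add_left_inj]

theorem numContexts_phiAct (a b : ZMod N) (π : Equiv.Perm (ZMod N)) :
    numContexts N (phiAct N a b π) = numContexts N π := by
  rw [numContexts, numContexts]
  congr 1
  symm
  refine Set.ncard_congr (fun pq _ => (pq.1 + b, pq.2 + b)) ?_ ?_ ?_
  · exact fun pq h => (validContext_phiAct a b pq.1 pq.2 π).2 h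
  · intro x y _ _ h
    simpa [Prod.ext_iff] using h
  · rintro ⟨p, q⟩ h
    refine ⟨(p - b, q - b), (validContext_phiAct a b _ _ π).1 ?_, by simp⟩
    simpa using h

theorem even_ncard_validContext (π : Equiv.Perm (ZMod N)) :
    Even {pq : ZMod N × ZMod N | ValidContext N π pq.1 pq.2}.ncard := by
  refine even_ncard_of_swap _ ?_ (fun x hx => hx.1)
  intro x hx
  exact ⟨hx.1.symm, hx.2.symm⟩

/-- A symmetry of `π` forces the order of its translation part to divide the number of valid
pointer contexts. -/
theorem addOrderOf_dvd_numContexts (hN : Odd N) {a b : ZMod N} {π : Equiv.Perm (ZMod N)}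
    (h : phiAct N a b π = π) : addOrderOf b ∣ numContexts N π := by
  set S := {pq : ZMod N × ZMod N | ValidContext N π pq.1 pq.2} with hS
  have hb : ∀ pq : ZMod N × ZMod N, b +ᵥ pq ∈ S ↔ pq ∈ S := by
    intro pq
    have := validContext_phiAct a b pq.1 pq.2 π
    rw [h, add_comm, add_comm pq.2] at this
    exact this
  have hmem : ∀ c ∈ AddSubgroup.zmultiples b, ∀ pq : ZMod N × ZMod N, c +ᵥ pq ∈ S ↔ pq ∈ S := by
    intro c hc
    rw [AddSubgroup.zmultiples_eq_closure] at hc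
    induction hc using AddSubgroup.closure_induction with
    | mem x hx => rwa [Set.mem_singleton_iff.1 hx]
    | zero => simp
    | add x y _ _ hx hy => intro pq; rw [add_vadd, hx, hy]
    | neg x _ hx => intro pq; rw [← hx, vadd_neg_vadd]
  have hdvd : addOrderOf b ∣ S.ncard := by
    rw [← Nat.card_zmultiples]
    refine card_dvd_ncard_of_free S (fun g x hx => (hmem g g.2 x).2 hx) ?_
    intro g x _ hgx
    have h1 : (g : ZMod N) + x.1 = x.1 := congrArg Prod.fst hgx
    exact Subtype.ext (by simpa using h1)
  have hodd : Odd (addOrderOf b) := by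
    refine hN.of_dvd_nat ?_
    have := addOrderOf_dvd_natCard b
    rwa [Nat.card_zmod] at this
  obtain ⟨c, hc⟩ := even_ncard_validContext π
  have h2 : S.ncard = 2 * numContexts N π := by
    rw [numContexts, ← hS]
    rw [← hS] at hc
    omega
  rw [h2] at hdvd
  exact (Nat.Coprime.dvd_of_dvd_mul_left (Nat.coprime_two_right.2 hodd) hdvd)

end contexts

/-- The action of `ZMod N × ZMod N` on permutations by shifting positions and values. -/
abbrev phiAddAction (N : ℕ) : AddAction (ZMod N × ZMod N) (Equiv.Perm (ZMod N)) where
  vadd g π := phiAct N g.1 g.2 π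
  zero_vadd π := Equiv.ext fun x => by
    change π (x - 0) + 0 = π x
    simp
  add_vadd g h π := Equiv.ext fun x => by
    change π (x - (g.1 + h.1)) + (g.2 + h.2) = π (x - g.1 - h.1) + h.2 + g.2
    rw [sub_sub]
    ring

/-- If `k` is relatively prime to `2n-1`, then `|M_{2n,k}|` is congruent
to `0` modulo `(2n-1)²`. -/
theorem stmt15 (n k : ℕ) (hn : 0 < n) (hgcd : Nat.gcd k (2 * n - 1) = 1) :
    (2 * n - 1) ^ 2 ∣ (Mset n k).ncard := by
  obtain rfl | hn2 : n = 1 ∨ 2 ≤ n := by omega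
  · simp
  have : NeZero (2 * n - 1) := ⟨by omega⟩
  have hodd : Odd (2 * n - 1) := ⟨n - 1, by omega⟩
  let _ := phiAddAction (2 * n - 1)
  have hcard : Nat.card (ZMod (2 * n - 1) × ZMod (2 * n - 1)) = (2 * n - 1) ^ 2 := by
    rw [Nat.card_prod, Nat.card_zmod, sq]
  rw [← hcard]
  refine card_dvd_ncard_of_free (Mset n k) ?_ ?_
  · rintro ⟨a, b⟩ ρ ⟨hρ, hk⟩
    exact ⟨phiAct_mem_MsetAll hn2 a b hρ, (numContexts_phiAct a b ρ).trans hk⟩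
  · rintro ⟨a, b⟩ ρ ⟨-, hk⟩ h
    replace h : phiAct (2 * n - 1) a b ρ = ρ := h
    have hd := addOrderOf_dvd_numContexts hodd h
    have hd' := addOrderOf_dvd_natCard b
    rw [Nat.card_zmod] at hd'
    rw [hk] at hd
    have hb : b = 0 := by
      rw [← AddMonoid.addOrderOf_eq_one_iff]
      have hdk := Nat.dvd_gcd hd hd'
      rw [hgcd] at hdk
      exact Nat.dvd_one.1 hdk
    subst hb
    have ha := congrArg (fun σ : Equiv.Perm (ZMod (2 * n - 1)) => σ 0) h
    have ha' : ρ (0 - a) + 0 = ρ 0 := ha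
    rw [add_zero] at ha'
    have := ρ.injective ha'
    ext <;> simp_all
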